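/- arXiv:1705.01430 — 2 statements merged into one kernel-verified Lean document; each statement's English description precedes it below -/
import Mathlib

section
/- Fix positive integers d_0, ..., d_n. There exists a unique polynomial Res = Res_{d_0,...,d_n} in the universal coefficient ring U_{d_0,...,d_n} = ℤ[u_{i,α} : i = 0,...,n, |α| = d_i] with the following three properties: (1) for all homogeneous polynomials F_0, ..., F_n ∈ ℂ[x_0,...,x_n] of degrees d_0, ..., d_n respectively, the system F_0 = 0, ..., F_n = 0 has a nontrivial solution over ℂ (i.e., the common zero locus V(F_0,...,F_n) ⊂ ℙ^n_ℂ is nonempty) if and only if Res(F_0,...,F_n) = 0; (2) Res is irreducible, even when regarded as a polynomial with complex coefficients; (3) Res(x_0^{d_0}, ..., x_n^{d_n}) = 1. -/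
open MvPolynomial

/-- `Mono m e` is the type of exponent vectors of total degree `e` in `m` variables. -/
abbrev Mono (m e : ℕ) : Type := {α : Fin m → ℕ // ∑ j, α j = e}

instance (m e : ℕ) : Fintype (Mono m e) :=
  Fintype.subtype (Finset.Nat.antidiagonalTuple m e) fun _ => Finset.Nat.mem_antidiagonalTuple

/-- The exponent vector as a finitely supported function (a monomial of `MvPolynomial`). -/
noncomputable abbrev Mono.toFinsupp {m e : ℕ} (α : Mono m e) : Fin m →₀ ℕ :=
  Finsupp.equivFunOnFinite.symm α.1

/-- The index type for the variables `u_{i,α}` of the universal ring of coefficients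
`ℤ[u_{i,α} : i, |α| = d i]` for `m` forms of degrees `d 0, …, d (m-1)` in `m` variables. -/
abbrev CoeffIdx (m : ℕ) (d : Fin m → ℕ) : Type := Σ i : Fin m, Mono m (d i)

/-- Evaluation `P ↦ P(F_0, …, F_{m-1})` : each universal variable `u_{i,α}` is replaced by the
corresponding coefficient `c_{i,α}` of `F_i`. -/
noncomputable def resEval {m : ℕ} (d : Fin m → ℕ) (F : Fin m → MvPolynomial (Fin m) ℂ)
    (R : MvPolynomial (CoeffIdx m d) ℤ) : ℂ :=
  eval₂ (Int.castRingHom ℂ) (fun v => coeff v.2.toFinsupp (F v.1)) R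

/-- `IsResultant m d R` says that `R` is *the* resultant polynomial `Res_{d_0,…,d_n}` (`m = n+1`):
(1) for homogeneous `F_i` of degrees `d i`, the system `F_0 = ⋯ = F_n = 0` has a nontrivial
solution over `ℂ` iff `R(F_0,…,F_n) = 0`; (2) `R` is irreducible, even over `ℂ`;
(3) `R(x_0^{d_0},…,x_n^{d_n}) = 1`. -/
def IsResultant (m : ℕ) (d : Fin m → ℕ) (R : MvPolynomial (CoeffIdx m d) ℤ) : Prop :=
  (∀ F : Fin m → MvPolynomial (Fin m) ℂ, (∀ i, (F i).IsHomogeneous (d i)) →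
    ((∃ x : Fin m → ℂ, x ≠ 0 ∧ ∀ i, eval x (F i) = 0) ↔ resEval d F R = 0)) ∧
  Irreducible R ∧ Irreducible (MvPolynomial.map (Int.castRingHom ℂ) R) ∧
  resEval d (fun i => X i ^ d i) R = 1

/-- A prime ideal of `S[X]` over a UFD `S` that meets `S` trivially is principal. -/
theorem Polynomial.exists_eq_span_singleton_of_comap_C_eq_bot {S : Type*} [CommRing S] [IsDomain S]
    [UniqueFactorizationMonoid S] (Q : Ideal (Polynomial S)) [Q.IsPrime]
    (hQ : ∀ s : S, Polynomial.C s ∈ Q → s = 0) : ∃ f, Q = Ideal.span {f} := by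
  by_cases hbot : Q = ⊥
  · exact ⟨0, by simp [hbot]⟩
  obtain ⟨f, hfQ, hf⟩ := Ideal.IsPrime.exists_mem_prime_of_ne_bot ‹Q.IsPrime› hbot
  have hdeg : f.natDegree ≠ 0 := by
    intro h
    rw [Polynomial.eq_C_of_natDegree_eq_zero h] at hfQ
    apply hf.ne_zero
    rw [Polynomial.eq_C_of_natDegree_eq_zero h, hQ _ hfQ, Polynomial.C_0]
  have hprim : f.IsPrimitive := hf.irreducible.isPrimitive hdeg
  let K := FractionRing S
  have hirr : Irreducible (f.map (algebraMap S K)) :=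
    (hprim.irreducible_iff_irreducible_map_fraction_map).1 hf.irreducible
  refine ⟨f, le_antisymm (fun g hg => ?_) ((Ideal.span_singleton_le_iff_mem _).2 hfQ)⟩
  rw [Ideal.mem_span_singleton]
  by_cases hdvd : f.map (algebraMap S K) ∣ g.map (algebraMap S K)
  · obtain ⟨h, hh⟩ := hdvd
    have hl : h ∈ Polynomial.lifts (algebraMap S K) := by
      rw [← hprim.map_mul_mem_lifts_iff (K := K), ← hh]
      exact ⟨g, rfl⟩
    obtain ⟨h', rfl⟩ := hl
    refine ⟨h', Polynomial.map_injective _ (IsFractionRing.injective S K) ?_⟩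
    rw [hh, Polynomial.map_mul]
    rfl
  · exfalso
    obtain ⟨a, b, hab⟩ := hirr.coprime_iff_not_dvd.2 hdvd
    obtain ⟨s, hs, hsa⟩ := IsLocalization.integerNormalization_spec (nonZeroDivisors S) a
    obtain ⟨t, ht, htb⟩ := IsLocalization.integerNormalization_spec (nonZeroDivisors S) b
    set a' := IsLocalization.integerNormalization (nonZeroDivisors S) a
    set b' := IsLocalization.integerNormalization (nonZeroDivisors S) b
    rw [Algebra.smul_def, Polynomial.algebraMap_apply] at hsa htb
    have key : Polynomial.C (s * t) = Polynomial.C t * a' * f + Polynomial.C s * b' * g := by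
      apply Polynomial.map_injective _ (IsFractionRing.injective S K)
      simp only [Polynomial.map_add, Polynomial.map_mul, Polynomial.map_C, hsa, htb, map_mul]
      linear_combination
        (-(Polynomial.C (algebraMap S K s) * Polynomial.C (algebraMap S K t))) * hab
    have := hQ (s * t) (by
      rw [key]
      exact Q.add_mem (Q.mul_mem_left _ hfQ) (Q.mul_mem_left _ hg))
    rcases mul_eq_zero.1 this with h | h
    · exact nonZeroDivisors.ne_zero hs h
    · exact nonZeroDivisors.ne_zero ht h

/-- A prime ideal of a polynomial ring over a UFD containing no nonzero polynomial free of the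
variable `v` is principal. -/
theorem MvPolynomial.exists_eq_span_singleton_of_rename_val {k σ : Type*} [CommRing k] [IsDomain k]
    [UniqueFactorizationMonoid k] (v : σ) (P : Ideal (MvPolynomial σ k)) [P.IsPrime]
    (hP : ∀ g : MvPolynomial {w // w ≠ v} k, rename Subtype.val g ∈ P → g = 0) :
    ∃ f, P = Ideal.span {f} := by
  classical
  let e : MvPolynomial σ k ≃ₐ[k] Polynomial (MvPolynomial {w // w ≠ v} k) :=
    (renameEquiv k (Equiv.optionSubtypeNe v).symm).trans (optionEquivLeft k _)
  have he : ∀ g : MvPolynomial {w // w ≠ v} k, e.symm (Polynomial.C g) = rename Subtype.val g := by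
    intro g
    rw [AlgEquiv.symm_apply_eq]
    induction g using MvPolynomial.induction_on with
    | C a => simp [e, ← MvPolynomial.algebraMap_eq, optionEquivLeft_C]
    | add p q hp hq => rw [map_add, map_add, map_add, hp, hq]
    | mul_X p w hp =>
      rw [map_mul, map_mul, map_mul, hp]
      congr 1
      simp [e, Equiv.optionSubtypeNe_symm_of_ne w.2, optionEquivLeft_X_some]
  let Q : Ideal (Polynomial (MvPolynomial {w // w ≠ v} k)) := P.comap e.symm
  obtain ⟨f, hf⟩ := Polynomial.exists_eq_span_singleton_of_comap_C_eq_bot Q fun s hs =>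
    hP s (by rw [← he]; exact hs)
  refine ⟨e.symm f, Ideal.ext fun p => ?_⟩
  have h1 : p ∈ P ↔ e p ∈ Q := by simp [Q, Ideal.mem_comap]
  rw [h1, hf, Ideal.mem_span_singleton, Ideal.mem_span_singleton,
    ← map_dvd_iff e.symm, AlgEquiv.symm_apply_apply]

/-- A ring homomorphism `R[X] → B[X]` fixing `X` is injective if its reduction modulo `X` is
injective on `R`. -/
theorem Polynomial.injective_of_injective_coeff_zero {R B : Type*} [CommRing R] [CommRing B]
    (E : Polynomial R →+* Polynomial B) (hX : E Polynomial.X = Polynomial.X)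
    (h0 : ∀ r, (E (Polynomial.C r)).coeff 0 = 0 → r = 0) : Function.Injective E := by
  rw [injective_iff_map_eq_zero]
  suffices H : ∀ (N : ℕ) (p : Polynomial R), p.natDegree < N → E p = 0 → p = 0 from
    fun p hp => H _ p (Nat.lt_succ_self _) hp
  intro N
  induction N with
  | zero => intro p hp; omega
  | succ N ih =>
    intro p hp hEp
    have hsplit := Polynomial.divX_mul_X_add p
    have hc : p.coeff 0 = 0 := by
      apply h0
      have := congrArg (fun q => (E q).coeff 0) hsplit
      simpa [map_add, map_mul, hX, hEp] using this
    rw [hc, Polynomial.C_0, add_zero] at hsplit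
    have hE : E p.divX = 0 := by
      have := hEp
      rw [← hsplit, map_mul, hX] at this
      ext i
      simpa using congrArg (fun q => Polynomial.coeff q (i + 1)) this
    by_cases hd : p.natDegree = 0
    · rw [Polynomial.eq_C_of_natDegree_eq_zero hd, hc, Polynomial.C_0]
    · have := ih p.divX (by rw [Polynomial.natDegree_divX_eq_natDegree_tsub_one]; omega) hE
      rw [← hsplit, this, zero_mul]

/-- The monomial `x_i ^ e`. -/
def Mono.pure {m : ℕ} (i : Fin m) (e : ℕ) : Mono m e :=
  ⟨Pi.single i e, by simp⟩

/-- The value at `y` of the `j`-th form with coefficient vector `c`. -/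
def formEval {m : ℕ} {d : Fin m → ℕ} {A : Type*} [CommRing A] (c : CoeffIdx m d → A)
    (y : Fin m → A) (j : Fin m) : A :=
  ∑ α : Mono m (d j), c ⟨j, α⟩ * ∏ l, y l ^ α.1 l

/-- The `j`-th form with coefficient vector `c`. -/
noncomputable def coeffForm {m : ℕ} {d : Fin m → ℕ} {A : Type*} [CommRing A]
    (c : CoeffIdx m d → A) (j : Fin m) : MvPolynomial (Fin m) A :=
  ∑ α : Mono m (d j), monomial α.toFinsupp (c ⟨j, α⟩)

section Forms

variable {m : ℕ} {d : Fin m → ℕ} {A B : Type*} [CommRing A] [CommRing B]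

theorem Mono.pure_prod (y : Fin m → A) (i : Fin m) (e : ℕ) :
    ∏ l, y l ^ (Mono.pure i e).1 l = y i ^ e := by
  rw [Finset.prod_eq_single i]
  · simp [Mono.pure]
  · intro l _ hl
    simp [Mono.pure, Pi.single_eq_of_ne hl]
  · simp

theorem Mono.degree_toFinsupp {e : ℕ} (α : Mono m e) : α.toFinsupp.degree = e := by
  rw [Finsupp.degree_eq_sum]
  exact α.2

theorem Mono.toFinsupp_injective {e : ℕ} :
    Function.Injective (Mono.toFinsupp : Mono m e → Fin m →₀ ℕ) := fun _ _ h =>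
  Subtype.ext (Finsupp.equivFunOnFinite.symm.injective h)

theorem map_formEval (f : A →+* B) (c : CoeffIdx m d → A) (y : Fin m → A) (j : Fin m) :
    f (formEval c y j) = formEval (fun w => f (c w)) (fun l => f (y l)) j := by
  simp [formEval]

theorem formEval_sub (c c' : CoeffIdx m d → A) (y : Fin m → A) (j : Fin m) :
    formEval (fun w => c w - c' w) y j = formEval c y j - formEval c' y j := by
  simp [formEval, sub_mul, Finset.sum_sub_distrib]

theorem formEval_add (c c' : CoeffIdx m d → A) (y : Fin m → A) (j : Fin m) :
    formEval (fun w => c w + c' w) y j = formEval c y j + formEval c' y j := by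
  simp [formEval, add_mul, Finset.sum_add_distrib]

theorem formEval_const_mul (a : A) (c : CoeffIdx m d → A) (y : Fin m → A) (j : Fin m) :
    formEval (fun w => a * c w) y j = a * formEval c y j := by
  simp [formEval, mul_assoc, Finset.mul_sum]

open Classical in
theorem formEval_ite (μ : ∀ j, Mono m (d j)) (a : Fin m → A) (y : Fin m → A) (j : Fin m) :
    formEval (d := d) (fun w => if w.2 = μ w.1 then a w.1 else 0) y j =
      a j * ∏ l, y l ^ (μ j).1 l := by
  simp [formEval]

theorem formEval_smul (c : CoeffIdx m d → A) (t : A) (y : Fin m → A) (j : Fin m) :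
    formEval c (fun l => t * y l) j = t ^ d j * formEval c y j := by
  rw [formEval, formEval, Finset.mul_sum]
  refine Finset.sum_congr rfl fun α _ => ?_
  simp_rw [mul_pow]
  rw [Finset.prod_mul_distrib, Finset.prod_pow_eq_pow_sum, α.2]
  ring

theorem eval₂_coeffForm (f : A →+* B) (y : Fin m → B) (c : CoeffIdx m d → A) (j : Fin m) :
    eval₂ f y (coeffForm c j) = formEval (fun w => f (c w)) y j := by
  rw [coeffForm, formEval, eval₂_sum]
  refine Finset.sum_congr rfl fun α _ => ?_
  rw [eval₂_monomial, Finsupp.prod_fintype _ _ (by simp)]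
  rfl

theorem isHomogeneous_coeffForm (c : CoeffIdx m d → A) (j : Fin m) :
    (coeffForm c j).IsHomogeneous (d j) :=
  IsHomogeneous.sum _ _ _ fun α _ => isHomogeneous_monomial _ α.degree_toFinsupp

theorem coeff_coeffForm (c : CoeffIdx m d → A) (w : CoeffIdx m d) :
    coeff w.2.toFinsupp (coeffForm c w.1) = c w := by
  classical
  rw [coeffForm, coeff_sum, Finset.sum_eq_single w.2]
  · simp
  · intro β _ hβ
    rw [coeff_monomial, if_neg fun h => hβ (Mono.toFinsupp_injective h)]
  · simp

theorem coeffForm_coeff (F : Fin m → MvPolynomial (Fin m) A)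
    (hF : ∀ i, (F i).IsHomogeneous (d i)) (j : Fin m) :
    coeffForm (d := d) (fun w => coeff w.2.toFinsupp (F w.1)) j = F j := by
  classical
  ext β
  by_cases hβ : β.degree = d j
  · let α : Mono m (d j) := ⟨β, by rw [← hβ, Finsupp.degree_eq_sum]⟩
    have : β = α.toFinsupp := by ext; rfl
    rw [this]
    exact coeff_coeffForm (d := d) (fun w => coeff w.2.toFinsupp (F w.1)) ⟨j, α⟩
  · rw [(isHomogeneous_coeffForm _ j).coeff_eq_zero hβ, (hF j).coeff_eq_zero hβ]

end Forms

section Elimination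

variable (n : ℕ) (d : Fin (n + 1) → ℕ) (k : Type*) [CommRing k]

/-- The generic point `(1, x_1, …, x_n)`. -/
noncomputable def affinePoint : Fin (n + 1) → MvPolynomial (CoeffIdx (n + 1) d ⊕ Fin n) k :=
  Fin.cons 1 fun i => X (Sum.inr i)

open Classical in
/-- The parametrization of systems of forms vanishing at `(1, x_1, …, x_n)`: the coefficients of
`x_0 ^ d_j` are replaced so that all forms vanish at this point. -/
noncomputable def elimHom : MvPolynomial (CoeffIdx (n + 1) d) k →ₐ[k]
    MvPolynomial (CoeffIdx (n + 1) d ⊕ Fin n) k :=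
  aeval fun w => X (Sum.inl w) - if w.2 = Mono.pure 0 (d w.1) then
    formEval (fun w => X (Sum.inl w)) (affinePoint n d k) w.1 else 0

variable {n d k}

open Classical in
theorem elimHom_X (w : CoeffIdx (n + 1) d) : elimHom n d k (X w) =
    X (Sum.inl w) - if w.2 = Mono.pure 0 (d w.1) then
      formEval (fun w => X (Sum.inl w)) (affinePoint n d k) w.1 else 0 := by
  simp [elimHom]

theorem formEval_elimHom (j : Fin (n + 1)) :
    formEval (fun w => elimHom n d k (X w)) (affinePoint n d k) j = 0 := by
  classical
  simp_rw [elimHom_X]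
  rw [formEval_sub, formEval_ite (fun j => Mono.pure 0 (d j)), Mono.pure_prod]
  simp [affinePoint]

theorem map_elimHom {k' : Type*} [CommRing k'] (f : k →+* k')
    (p : MvPolynomial (CoeffIdx (n + 1) d) k) :
    elimHom n d k' (MvPolynomial.map f p) = MvPolynomial.map f (elimHom n d k p) := by
  classical
  induction p using MvPolynomial.induction_on with
  | C a => simp [← MvPolynomial.algebraMap_eq]
  | add p q hp hq => simp only [map_add, hp, hq]
  | mul_X p w hp =>
    have hy : ∀ l, MvPolynomial.map f (affinePoint n d k l) = affinePoint n d k' l := by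
      intro l
      refine Fin.cases ?_ (fun i => ?_) l <;> simp [affinePoint]
    simp only [map_mul, hp, map_X, elimHom_X, map_sub]
    split_ifs
    · rw [map_formEval]
      simp [hy]
    · simp

/-- Evaluating the parametrization at a system vanishing at `(1, x_1, …, x_n)` gives back the
system. -/
theorem eval_elimHom (c : CoeffIdx (n + 1) d → k) (x : Fin n → k)
    (h : ∀ j, formEval c (Fin.cons 1 x) j = 0) (p : MvPolynomial (CoeffIdx (n + 1) d) k) :
    eval (Sum.elim c x) (elimHom n d k p) = eval c p := by
  classical
  induction p using MvPolynomial.induction_on with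
  | C a => simp [← MvPolynomial.algebraMap_eq]
  | add p q hp hq => simp only [map_add, hp, hq]
  | mul_X p w hp =>
    have hy : ∀ l, eval (Sum.elim c x) (affinePoint n d k l) =
        (Fin.cons 1 x : Fin (n + 1) → k) l := by
      intro l
      refine Fin.cases ?_ (fun i => ?_) l <;> simp [affinePoint]
    simp only [map_mul, hp, eval_X, elimHom_X, map_sub]
    split_ifs
    · rw [map_formEval]
      simp [hy, h]
    · simp

/-- The exponent vector of `x_0 ^ (e - 1) * x_i`. -/
def Mono.linear (i : Fin n) (e : ℕ) (he : 0 < e) : Mono (n + 1) e :=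
  ⟨Pi.single 0 (e - 1) + Pi.single i.succ 1, by simp [Finset.sum_add_distrib]; omega⟩

theorem Mono.linear_ne_pure (i : Fin n) (e : ℕ) (he : 0 < e) :
    Mono.linear i e he ≠ Mono.pure 0 e := by
  intro h
  have := congrFun (congrArg Subtype.val h) i.succ
  simp [Mono.linear, Mono.pure, Fin.succ_ne_zero] at this

theorem Mono.linear_prod {A : Type*} [CommRing A] (y : Fin (n + 1) → A) (hy : y 0 = 1) (i : Fin n)
    (e : ℕ) (he : 0 < e) : ∏ l, y l ^ (Mono.linear i e he).1 l = y i.succ := by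
  rw [Fin.prod_univ_succ, hy, one_pow, one_mul, Finset.prod_eq_single i]
  · simp [Mono.linear, Fin.succ_ne_zero]
  · intro l _ hl
    simp [Mono.linear, Fin.succ_ne_zero, hl]
  · simp

/-- No nonzero element of the kernel of `elimHom` is free of the coefficient of `x_0 ^ d_n` in the
last form: the first `n` forms can be prescribed generically. -/
theorem eq_zero_of_elimHom_rename (hd : ∀ i, 0 < d i) (v : CoeffIdx (n + 1) d)
    (hv : v = ⟨Fin.last n, Mono.pure 0 _⟩) (g : MvPolynomial {w // w ≠ v} k)
    (hg : elimHom n d k (rename Subtype.val g) = 0) : g = 0 := by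
  classical
  -- the system is deformed along `s` from `F_i = x_0 ^ (d_i - 1) * x_{i+1}` at `s = 0`
  let μ : ∀ j : Fin (n + 1), Mono (n + 1) (d j) := fun j =>
    Fin.lastCases (motive := fun j => Mono (n + 1) (d j)) (Mono.pure 0 _)
      (fun i => Mono.linear i _ (hd _)) j
  let a : Fin (n + 1) → ℕ := fun j => if j = Fin.last n then 0 else 1
  let b : CoeffIdx (n + 1) d → ℕ := fun w => if w.2 = μ w.1 then a w.1 else 0
  have hb0 : ∀ j, b ⟨j, Mono.pure 0 (d j)⟩ = 0 := by
    intro j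
    refine Fin.lastCases ?_ (fun i => ?_) j
    · simp [b, a]
    · simp [b, μ, (Mono.linear_ne_pure _ _ _).symm]
  let y := affinePoint n d k
  let f := formEval (fun w => X (Sum.inl w)) y
  obtain ⟨θ, hθl, hθr⟩ : ∃ θ : MvPolynomial (CoeffIdx (n + 1) d ⊕ Fin n) k →ₐ[k]
      Polynomial (MvPolynomial (CoeffIdx (n + 1) d ⊕ Fin n) k),
      (∀ w, θ (X (Sum.inl w)) =
        ((b w : ℕ) : Polynomial _) + Polynomial.X * Polynomial.C (X (Sum.inl w))) ∧
      ∀ i, θ (X (Sum.inr i)) = Polynomial.C (X (Sum.inr i)) :=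
    ⟨aeval (Sum.elim
      (fun w => ((b w : ℕ) : Polynomial _) + Polynomial.X * Polynomial.C (X (Sum.inl w)))
      (fun i => Polynomial.C (X (Sum.inr i)))),
      fun w => by rw [aeval_X, Sum.elim_inl], fun i => by rw [aeval_X, Sum.elim_inr]⟩
  obtain ⟨Θ, hΘp, hΘn⟩ : ∃ Θ : MvPolynomial {w // w ≠ v} k →ₐ[k]
      Polynomial (MvPolynomial {w // w ≠ v} k),
      (∀ w : {w // w ≠ v}, w.1.2 = Mono.pure 0 _ → Θ (X w) = Polynomial.C (X w)) ∧
      ∀ w : {w // w ≠ v}, w.1.2 ≠ Mono.pure 0 _ →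
        Θ (X w) = ((b w.1 : ℕ) : Polynomial _) + Polynomial.X * Polynomial.C (X w) :=
    ⟨aeval fun w => if w.1.2 = Mono.pure 0 _ then Polynomial.C (X w)
      else ((b w.1 : ℕ) : Polynomial _) + Polynomial.X * Polynomial.C (X w),
      fun w hw => by rw [aeval_X, if_pos hw], fun w hw => by rw [aeval_X, if_neg hw]⟩
  obtain ⟨c, hcp, hcn⟩ : ∃ c : {w // w ≠ v} →
      Polynomial (MvPolynomial (CoeffIdx (n + 1) d ⊕ Fin n) k),
      (∀ w : {w // w ≠ v}, w.1.2 = Mono.pure 0 _ → c w =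
        Polynomial.X * Polynomial.C (X (Sum.inl w.1)) -
          (Polynomial.C (a w.1.1 * ∏ l, y l ^ (μ w.1.1).1 l) +
            Polynomial.X * Polynomial.C (f w.1.1))) ∧
      ∀ w : {w // w ≠ v}, w.1.2 ≠ Mono.pure 0 _ → c w = Polynomial.C (X (Sum.inl w.1)) :=
    ⟨fun w => if w.1.2 = Mono.pure 0 _ then
      Polynomial.X * Polynomial.C (X (Sum.inl w.1)) -
        (Polynomial.C (a w.1.1 * ∏ l, y l ^ (μ w.1.1).1 l) + Polynomial.X * Polynomial.C (f w.1.1))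
      else Polynomial.C (X (Sum.inl w.1)),
      fun w hw => by beta_reduce; rw [if_pos hw], fun w hw => by beta_reduce; rw [if_neg hw]⟩
  obtain ⟨E, hEX, hEC⟩ : ∃ E : Polynomial (MvPolynomial {w // w ≠ v} k) →+*
      Polynomial (MvPolynomial (CoeffIdx (n + 1) d ⊕ Fin n) k),
      E Polynomial.X = Polynomial.X ∧ ∀ p, E (Polynomial.C p) = aeval (R := k) c p :=
    ⟨Polynomial.eval₂RingHom (aeval (R := k) c : _ →+* _) Polynomial.X, by simp, by simp⟩
  have hθy : ∀ l, θ (y l) = Polynomial.C (y l) := by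
    intro l
    refine Fin.cases ?_ (fun i => ?_) l
    · simp [y, affinePoint]
    · simp [y, affinePoint, hθr]
  have hθf : ∀ j, θ (f j) =
      Polynomial.C (a j * ∏ l, y l ^ (μ j).1 l) + Polynomial.X * Polynomial.C (f j) := by
    intro j
    have h1 := map_formEval (B := Polynomial (MvPolynomial (CoeffIdx (n + 1) d ⊕ Fin n) k))
      (θ : _ →+* _) (fun w => X (Sum.inl w)) y j
    simp only [RingHom.coe_coe, hθy, hθl] at h1
    have h1' := map_formEval (B := Polynomial (MvPolynomial (CoeffIdx (n + 1) d ⊕ Fin n) k))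
      Polynomial.C (fun w => X (Sum.inl w)) y j
    rw [h1, formEval_add, formEval_const_mul, ← h1']
    congr 1
    have h2 := formEval_ite μ
      (fun j => ((a j : ℕ) : Polynomial (MvPolynomial (CoeffIdx (n + 1) d ⊕ Fin n) k)))
      (fun l => Polynomial.C (y l)) j
    rw [map_mul, map_prod, map_natCast]
    simp only [map_pow]
    rw [← h2]
    congr 1
    ext1 w
    simp only [b]
    split_ifs <;> simp
  have hcomm : ∀ p, θ (elimHom n d k (rename Subtype.val p)) = E (Θ p) := by
    intro p
    induction p using MvPolynomial.induction_on with
    | C r =>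
      rw [rename_C, ← MvPolynomial.algebraMap_eq, AlgHom.commutes, AlgHom.commutes,
        ← MvPolynomial.algebraMap_eq, AlgHom.commutes, Polynomial.algebraMap_apply,
        Polynomial.algebraMap_apply, hEC, AlgHom.commutes, Polynomial.algebraMap_apply]
    | add p q hp hq => simp only [map_add, hp, hq]
    | mul_X p w hp =>
      rw [map_mul, map_mul, map_mul, map_mul, map_mul, hp]
      congr 1
      rw [rename_X, elimHom_X, map_sub, hθl]
      by_cases hw : w.1.2 = Mono.pure 0 _
      · have hbw : b w.1 = 0 := by
          have h4 : w.1 = ⟨w.1.1, Mono.pure 0 (d w.1.1)⟩ := by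
            rw [← hw]
          rw [h4]
          exact hb0 _
        rw [if_pos hw, hbw, hΘp w hw, hEC, aeval_X, hcp w hw]
        have h5 := hθf w.1.1
        simp only [f, y] at h5
        rw [h5, Nat.cast_zero, zero_add]
      · rw [if_neg hw, hΘn w hw, map_zero, sub_zero, map_add, map_mul, hEC, hEX, aeval_X,
          hcn w hw, map_natCast]
  have hE : Function.Injective E := by
    apply Polynomial.injective_of_injective_coeff_zero _ hEX
    intro p hp
    obtain ⟨l, hll, hlr⟩ : ∃ l : MvPolynomial (CoeffIdx (n + 1) d ⊕ Fin n) k →ₐ[k]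
        MvPolynomial {w // w ≠ v} k,
        (∀ w : {w // w ≠ v}, l (X (Sum.inl w.1)) = X w) ∧
        ∀ (i : Fin n) (h : ⟨i.castSucc, Mono.pure 0 _⟩ ≠ v),
          l (X (Sum.inr i)) = - X ⟨⟨i.castSucc, Mono.pure 0 _⟩, h⟩ := by
      refine ⟨aeval (Sum.elim (fun w => if h : w ≠ v then X ⟨w, h⟩ else 0)
        (fun i => - X ⟨⟨i.castSucc, Mono.pure 0 _⟩, fun h =>
          (Fin.castSucc_lt_last i).ne (congrArg Sigma.fst (h.trans hv))⟩)),
        fun w => ?_, fun i h => ?_⟩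
      · rw [aeval_X, Sum.elim_inl, dif_pos w.2]
      · rw [aeval_X, Sum.elim_inr]
    have h6 : (l.comp ((Polynomial.aeval (0 : MvPolynomial (CoeffIdx (n + 1) d ⊕ Fin n) k)
        ).restrictScalars k)).comp (aeval (R := k) c) = AlgHom.id k _ := by
      apply MvPolynomial.algHom_ext
      rintro ⟨⟨j, α⟩, hw⟩
      rw [AlgHom.comp_apply, aeval_X]
      by_cases hα : α = Mono.pure 0 _
      · subst hα
        rw [hcp _ rfl]
        revert hw
        refine Fin.lastCases (fun hw => absurd hv.symm hw) (fun i hw => ?_) j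
        have h7 : ∏ t, y t ^ (Mono.linear i (d i.castSucc) (hd _)).1 t = X (Sum.inr i) := by
          rw [Mono.linear_prod y rfl]
          simp [y, affinePoint]
        simp [a, μ, h7, hlr i hw, (Fin.castSucc_lt_last i).ne]
      · rw [hcn _ hα]
        simp [hll ⟨⟨j, α⟩, hw⟩]
    have h7 := DFunLike.congr_fun h6 p
    rw [AlgHom.comp_apply, ← hEC, AlgHom.comp_apply, AlgHom.restrictScalars_apply,
      ← Polynomial.coeff_zero_eq_aeval_zero, hp, map_zero] at h7
    exact h7.symm
  have hΘ : ∀ p, Θ p = 0 → p = 0 := by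
    intro p hp
    obtain ⟨r, hrp, hrn⟩ : ∃ r : MvPolynomial {w // w ≠ v} k →ₐ[k] MvPolynomial {w // w ≠ v} k,
        (∀ w : {w // w ≠ v}, w.1.2 = Mono.pure 0 _ → r (X w) = X w) ∧
        ∀ w : {w // w ≠ v}, w.1.2 ≠ Mono.pure 0 _ →
          r (X w) = X w - ((b w.1 : ℕ) : MvPolynomial _ k) :=
      ⟨aeval fun w => if w.1.2 = Mono.pure 0 _ then X w
        else X w - ((b w.1 : ℕ) : MvPolynomial _ k),
        fun w hw => by rw [aeval_X, if_pos hw], fun w hw => by rw [aeval_X, if_neg hw]⟩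
    have h8 : (Polynomial.eval₂RingHom r.toRingHom 1).comp Θ.toRingHom = RingHom.id _ := by
      apply MvPolynomial.ringHom_ext
      · intro t
        simp [← MvPolynomial.algebraMap_eq, Polynomial.algebraMap_apply]
      · intro w
        by_cases hw : w.1.2 = Mono.pure 0 _
        · simp [hΘp w hw, hrp w hw]
        · simp [hΘn w hw, hrn w hw]
    have h9 := DFunLike.congr_fun h8 p
    rw [RingHom.comp_apply, show Θ.toRingHom p = 0 from hp, map_zero] at h9
    exact h9.symm
  apply hΘ
  apply hE
  rw [← hcomm, hg, map_zero, map_zero]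

end Elimination

/-- Elimination: if all monomials of degree `D` lie in degree `D` of the ideal of the forms with
coefficients `c`, then some polynomial in the kernel of `elimHom` takes the value `1` at `c`. -/
theorem exists_elimHom_eq_zero {n : ℕ} {d : Fin (n + 1) → ℕ} {k : Type*} [CommRing k]
    (c : CoeffIdx (n + 1) d → k) (D : ℕ)
    (h : ∀ β : Fin (n + 1) →₀ ℕ, β.degree = D → monomial β (1 : k) ∈ Submodule.span k
      {p | ∃ γ j, γ.degree + d j = D ∧ p = monomial γ 1 * coeffForm c j}) :
    ∃ r : MvPolynomial (CoeffIdx (n + 1) d) k, eval c r = 1 ∧ elimHom n d k r = 0 := by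
  classical
  let N : Submodule (MvPolynomial (CoeffIdx (n + 1) d) k)
      (MvPolynomial (Fin (n + 1)) (MvPolynomial (CoeffIdx (n + 1) d) k)) :=
    Submodule.span _ ((fun β => monomial β 1) '' {β : Fin (n + 1) →₀ ℕ | β.degree = D})
  let I : Submodule (MvPolynomial (CoeffIdx (n + 1) d) k)
      (MvPolynomial (Fin (n + 1)) (MvPolynomial (CoeffIdx (n + 1) d) k)) :=
    (Ideal.span (Set.range (coeffForm (d := d)
      (fun w => (X w : MvPolynomial (CoeffIdx (n + 1) d) k))))).restrictScalars _
  have hmem : ∀ β : Fin (n + 1) →₀ ℕ, β.degree = D → monomial β 1 ∈ N := fun β hβ =>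
    Submodule.subset_span ⟨β, hβ, rfl⟩
  have hfin : N.FG := by
    refine Submodule.fg_span (Set.Finite.image _ ?_)
    have : {β : Fin (n + 1) →₀ ℕ | β.degree = D} ⊆
        (Set.range fun α : Mono (n + 1) D => α.toFinsupp) := by
      intro β hβ
      refine ⟨⟨β, by rw [← hβ, Finsupp.degree_eq_sum]⟩, ?_⟩
      ext; rfl
    exact (Set.finite_range _).subset this
  have hgen : ∀ p ∈ Submodule.span k
      {p | ∃ γ j, γ.degree + d j = D ∧ p = monomial γ (1 : k) * coeffForm c j},
      MvPolynomial.map (C : k →+* MvPolynomial (CoeffIdx (n + 1) d) k) p ∈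
        I ⊔ RingHom.ker (eval c) • N := by
    intro p hp
    induction hp using Submodule.span_induction with
    | zero => simp
    | add p q _ _ hp hq => rw [map_add]; exact add_mem hp hq
    | smul a p _ hp =>
      rw [smul_eq_C_mul, map_mul, map_C, ← smul_eq_C_mul]
      exact Submodule.smul_mem _ _ hp
    | mem p hp =>
      obtain ⟨γ, j, hγ, rfl⟩ := hp
      have h1 : MvPolynomial.map (C : k →+* MvPolynomial (CoeffIdx (n + 1) d) k)
          (monomial γ (1 : k) * coeffForm c j) =
          monomial γ 1 * coeffForm (fun w => X w) j +
            ∑ α : Mono (n + 1) (d j), (C (c ⟨j, α⟩) - X (⟨j, α⟩ : CoeffIdx (n + 1) d)) •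
              monomial (γ + α.toFinsupp) (1 : MvPolynomial (CoeffIdx (n + 1) d) k) := by
        simp only [coeffForm, Finset.mul_sum, map_sum, ← Finset.sum_add_distrib, map_mul,
          map_monomial, monomial_mul, smul_monomial, ← map_add]
        refine Finset.sum_congr rfl fun α _ => ?_
        congr 1
        simp
      rw [h1]
      refine Submodule.add_mem_sup ?_ (sum_mem fun α _ => ?_)
      · exact (Ideal.span (Set.range (coeffForm (d := d)
          (fun w => (X w : MvPolynomial (CoeffIdx (n + 1) d) k))))).mul_mem_left _
          (Ideal.subset_span ⟨j, rfl⟩)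
      · refine Submodule.smul_mem_smul (by simp [RingHom.mem_ker]) (hmem _ ?_)
        rw [map_add, α.degree_toFinsupp, hγ]
  have hle : N ≤ I ⊔ RingHom.ker (eval c) • N := by
    refine Submodule.span_le.2 ?_
    rintro _ ⟨β, hβ, rfl⟩
    have := hgen _ (h β hβ)
    rwa [map_monomial, map_one] at this
  obtain ⟨r, hr, hrN⟩ := Submodule.exists_sub_one_mem_and_smul_le_of_fg_of_le_sup hfin le_rfl hle
  refine ⟨r, ?_, ?_⟩
  · rw [RingHom.mem_ker, map_sub, map_one, sub_eq_zero] at hr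
    exact hr
  · have h2 : r • monomial (Finsupp.single 0 D) 1 ∈ I :=
      hrN (Submodule.smul_mem_pointwise_smul _ _ _ (hmem _ (by simp)))
    have h3 : Ideal.span (Set.range (coeffForm (d := d)
        (fun w => (X w : MvPolynomial (CoeffIdx (n + 1) d) k)))) ≤
        RingHom.ker (eval₂Hom (elimHom n d k : _ →+* _) (affinePoint n d k)) := by
      rw [Ideal.span_le]
      rintro _ ⟨j, rfl⟩
      exact (eval₂_coeffForm _ _ _ _).trans (formEval_elimHom j)
    have h4 := h3 h2
    rw [RingHom.mem_ker, smul_monomial] at h4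
    simpa [affinePoint, eval₂Hom_monomial] using h4

theorem resEval_eq_eval {m : ℕ} (d : Fin m → ℕ) (F : Fin m → MvPolynomial (Fin m) ℂ)
    (R : MvPolynomial (CoeffIdx m d) ℤ) : resEval d F R =
      eval (fun w => coeff w.2.toFinsupp (F w.1)) (MvPolynomial.map (Int.castRingHom ℂ) R) := by
  rw [resEval, eval_map]

theorem resEval_X_pow {m : ℕ} (d : Fin m → ℕ) (R : MvPolynomial (CoeffIdx m d) ℤ) :
    resEval d (fun i => X i ^ d i) R =
      (eval (fun w => coeff w.2.toFinsupp (X w.1 ^ d w.1 : MvPolynomial (Fin m) ℤ)) R : ℤ) := by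
  have h := eval₂_comp_left (Int.castRingHom ℂ) (RingHom.id ℤ)
    (fun w : CoeffIdx m d => coeff w.2.toFinsupp (X w.1 ^ d w.1 : MvPolynomial (Fin m) ℤ)) R
  rw [eval₂_id, RingHom.comp_id] at h
  refine Eq.trans ?_ h.symm
  rw [resEval]
  congr 1
  ext1 w
  rw [Function.comp_apply, ← coeff_map, map_pow, map_X]

/-- Over `ℤ`, the kernel of `elimHom` is generated by one polynomial, normalized at
`x_0 ^ d_0, …, x_n ^ d_n`. -/
theorem exists_ker_elimHom_eq_span {n : ℕ} {d : Fin (n + 1) → ℕ} (hd : ∀ i, 0 < d i) :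
    ∃ R : MvPolynomial (CoeffIdx (n + 1) d) ℤ, resEval d (fun i => X i ^ d i) R = 1 ∧
      RingHom.ker (elimHom n d ℤ) = Ideal.span {R} := by
  obtain ⟨r, hr1, hr⟩ := exists_elimHom_eq_zero (d := d)
    (fun w => coeff w.2.toFinsupp (X w.1 ^ d w.1 : MvPolynomial (Fin (n + 1)) ℤ)) (∑ i, d i) (by
      intro β hβ
      obtain ⟨j, hj⟩ : ∃ j, d j ≤ β j := by
        by_contra! hlt
        rw [Finsupp.degree_eq_sum] at hβ
        exact (Finset.sum_lt_sum_of_nonempty ⟨0, Finset.mem_univ _⟩ fun i _ => hlt i).ne hβ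
      have hle : Finsupp.single j (d j) ≤ β := by simpa using hj
      refine Submodule.subset_span ⟨β - Finsupp.single j (d j), j, ?_, ?_⟩
      · rw [← hβ]
        conv_rhs => rw [← tsub_add_cancel_of_le hle]
        rw [map_add, Finsupp.degree_single]
      · rw [coeffForm_coeff (fun i => X i ^ d i) (fun i => isHomogeneous_X_pow i (d i)),
          X_pow_eq_monomial, monomial_mul, tsub_add_cancel_of_le hle, one_mul])
  have : (RingHom.ker (elimHom n d ℤ)).IsPrime := RingHom.ker_isPrime _
  obtain ⟨R, hR⟩ := MvPolynomial.exists_eq_span_singleton_of_rename_val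
    (⟨Fin.last n, Mono.pure 0 _⟩ : CoeffIdx (n + 1) d) (RingHom.ker (elimHom n d ℤ))
    (fun g hg => eq_zero_of_elimHom_rename hd _ rfl g hg)
  have hRr : R ∣ r := by
    rw [← Ideal.mem_span_singleton, ← hR]
    exact hr
  have hunit := isUnit_of_dvd_one (hr1 ▸ map_dvd (eval _) hRr)
  rcases Int.isUnit_iff.1 hunit with h | h
  · exact ⟨R, by rw [resEval_X_pow, h, Int.cast_one], hR⟩
  · exact ⟨-R, by rw [resEval_X_pow, map_neg, h, neg_neg, Int.cast_one], by
      rw [hR, Ideal.span_singleton_neg]⟩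

open TensorProduct in
/-- A generator of the kernel of `elimHom` over `ℤ` also generates it over `ℂ`. -/
theorem ker_elimHom_map {n : ℕ} {d : Fin (n + 1) → ℕ} {R : MvPolynomial (CoeffIdx (n + 1) d) ℤ}
    (hR : RingHom.ker (elimHom n d ℤ) = Ideal.span {R}) :
    RingHom.ker (elimHom n d ℂ) = Ideal.span {MvPolynomial.map (Int.castRingHom ℂ) R} := by
  have hmap : ∀ p : MvPolynomial (CoeffIdx (n + 1) d) ℤ, elimHom n d ℂ
      (MvPolynomial.map (Int.castRingHom ℂ) p) =
      MvPolynomial.map (Int.castRingHom ℂ) (elimHom n d ℤ p) := map_elimHom _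
  apply le_antisymm
  · intro f hf
    have hcomm : ∀ t : ℂ ⊗[ℤ] MvPolynomial (CoeffIdx (n + 1) d) ℤ,
        elimHom n d ℂ (algebraTensorAlgEquiv ℤ ℂ t) =
          algebraTensorAlgEquiv ℤ ℂ (LinearMap.lTensor ℂ (elimHom n d ℤ).toLinearMap t) := by
      intro t
      induction t with
      | zero => simp
      | add s t hs ht => simp only [map_add, hs, ht]
      | tmul a p =>
        rw [LinearMap.lTensor_tmul, algebraTensorAlgEquiv_tmul, algebraTensorAlgEquiv_tmul,
          map_smul]
        congr 1
        exact hmap p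
    have hmul : ∀ t : ℂ ⊗[ℤ] MvPolynomial (CoeffIdx (n + 1) d) ℤ,
        algebraTensorAlgEquiv ℤ ℂ (LinearMap.lTensor ℂ (LinearMap.mulLeft ℤ R) t) =
          MvPolynomial.map (Int.castRingHom ℂ) R * algebraTensorAlgEquiv ℤ ℂ t := by
      intro t
      induction t with
      | zero => simp
      | add s t hs ht => simp only [map_add, hs, ht, mul_add]
      | tmul a p =>
        rw [LinearMap.lTensor_tmul, algebraTensorAlgEquiv_tmul, algebraTensorAlgEquiv_tmul,
          LinearMap.mulLeft_apply, map_mul, mul_smul_comm]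
        rfl
    have hex : Function.Exact (LinearMap.mulLeft ℤ R) (elimHom n d ℤ).toLinearMap := by
      intro p
      change p ∈ RingHom.ker (elimHom n d ℤ) ↔ _
      rw [hR, Ideal.mem_span_singleton]
      exact ⟨fun ⟨q, hq⟩ => ⟨q, hq.symm⟩, fun ⟨q, hq⟩ => ⟨q, hq.symm⟩⟩
    obtain ⟨t, rfl⟩ := (algebraTensorAlgEquiv ℤ ℂ).surjective f
    rw [RingHom.mem_ker, hcomm, EmbeddingLike.map_eq_zero_iff] at hf
    obtain ⟨s, rfl⟩ := (Module.Flat.lTensor_exact ℂ hex t).1 hf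
    rw [hmul]
    exact Ideal.mul_mem_right _ _ (Ideal.mem_span_singleton_self _)
  · rw [Ideal.span_singleton_le_iff_mem, RingHom.mem_ker, hmap]
    have : R ∈ RingHom.ker (elimHom n d ℤ) := hR ▸ Ideal.mem_span_singleton_self R
    rw [show elimHom n d ℤ R = 0 from this, map_zero]

/-- The kernel of `elimHom` vanishes at all systems of forms with a common nontrivial zero; zeros
with `x_0 = 0` are limits of the others. -/
theorem eval_eq_zero_of_formEval_eq_zero {n : ℕ} {d : Fin (n + 1) → ℕ}
    {R : MvPolynomial (CoeffIdx (n + 1) d) ℂ} (hR : elimHom n d ℂ R = 0)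
    (c : CoeffIdx (n + 1) d → ℂ) (x : Fin (n + 1) → ℂ) (hx : x ≠ 0)
    (h : ∀ j, formEval c x j = 0) : eval c R = 0 := by
  classical
  have key : ∀ (c : CoeffIdx (n + 1) d → ℂ) (x : Fin (n + 1) → ℂ), x 0 ≠ 0 →
      (∀ j, formEval c x j = 0) → eval c R = 0 := by
    intro c x hx h
    have h1 : (fun l => (x 0)⁻¹ * x l) =
        (Fin.cons 1 fun i => (x 0)⁻¹ * x i.succ : Fin (n + 1) → ℂ) := by
      funext l
      refine Fin.cases ?_ (fun i => ?_) l
      · simp [hx]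
      · simp
    rw [← eval_elimHom c (fun i => (x 0)⁻¹ * x i.succ), hR, map_zero]
    intro j
    rw [← h1, formEval_smul, h, mul_zero]
  by_cases hx0 : x 0 = 0
  · obtain ⟨i, hi⟩ := Function.ne_iff.1 hx
    have hi0 : i ≠ 0 := fun h => hi (h ▸ hx0)
    let y : ℂ → Fin (n + 1) → ℂ := fun s => Function.update x 0 s
    let e : ℂ → CoeffIdx (n + 1) d → ℂ := fun s w =>
      c w - if w.2 = Mono.pure i (d w.1) then (x i ^ d w.1)⁻¹ * formEval c (y s) w.1 else 0
    have hy : Continuous y := continuous_const.update 0 continuous_id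
    have he : Continuous e := by
      refine continuous_pi fun w => continuous_const.sub ?_
      split_ifs
      · refine continuous_const.mul ?_
        unfold formEval
        fun_prop
      · exact continuous_const
    have h0 : e 0 = c := by
      funext w
      have : y 0 = x := by
        simp [y, ← hx0]
      simp [e, this, h]
    have hs : ∀ s, s ≠ 0 → eval (e s) R = 0 := by
      intro s hs
      refine key (e s) (y s) (by simpa [y] using hs) fun j => ?_
      have h2 := formEval_ite (fun j => Mono.pure i (d j))
        (fun j => (x i ^ d j)⁻¹ * formEval c (y s) j) (y s) j
      rw [Mono.pure_prod] at h2
      rw [formEval_sub, h2]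
      have : y s i = x i := Function.update_of_ne hi0 _ _
      have hxi : x i ^ d j ≠ 0 := pow_ne_zero _ hi
      rw [this]
      field_simp
      simp
    have := Continuous.ext_on (dense_compl_singleton (0 : ℂ)) ((continuous_eval R).comp he)
      (continuous_const (y := (0 : ℂ))) fun s hs' => hs s hs'
    have := congrFun this 0
    rwa [Function.comp_apply, h0] at this
  · exact key c x hx0 h

theorem homogeneousComponent_mem_span {m : ℕ} {d : Fin m → ℕ} {k : Type*} [CommRing k]
    (c : CoeffIdx m d → k) (D : ℕ) {p : MvPolynomial (Fin m) k}
    (hp : p ∈ Ideal.span (Set.range (coeffForm c))) :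
    homogeneousComponent D p ∈ Submodule.span k
      {p | ∃ γ j, γ.degree + d j = D ∧ p = monomial γ (1 : k) * coeffForm c j} := by
  obtain ⟨g, rfl⟩ := (Submodule.mem_span_range_iff_exists_fun _).1 hp
  rw [map_sum]
  refine sum_mem fun j _ => ?_
  rw [smul_eq_mul]
  generalize g j = q
  induction q using MvPolynomial.induction_on' with
  | monomial γ a =>
    have hhom : (monomial γ a * coeffForm c j).IsHomogeneous (γ.degree + d j) :=
      (isHomogeneous_monomial a rfl).mul (isHomogeneous_coeffForm c j)
    rw [homogeneousComponent_of_mem hhom]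
    split_ifs with hD
    · rw [← mul_one a, ← smul_eq_mul a, ← smul_monomial, smul_mul_assoc]
      exact Submodule.smul_mem _ _ (Submodule.subset_span ⟨γ, j, hD.symm, rfl⟩)
    · exact zero_mem _
  | add p q hp hq =>
    rw [add_mul, map_add]
    exact add_mem hp hq

/-- At a system of forms without common nontrivial zeros, some element of the kernel of `elimHom`
takes the value `1`. -/
theorem exists_eval_eq_one_of_formEval {n : ℕ} {d : Fin (n + 1) → ℕ}
    (c : CoeffIdx (n + 1) d → ℂ) (h : ∀ x, (∀ j, formEval c x j = 0) → x = 0) :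
    ∃ r : MvPolynomial (CoeffIdx (n + 1) d) ℂ, eval c r = 1 ∧ elimHom n d ℂ r = 0 := by
  have hrad : idealOfVars (Fin (n + 1)) ℂ ≤ (Ideal.span (Set.range (coeffForm c))).radical := by
    rw [← vanishingIdeal_zeroLocus_eq_radical (K := ℂ), idealOfVars, Ideal.span_le]
    rintro _ ⟨i, rfl⟩
    rw [SetLike.mem_coe, mem_vanishingIdeal_iff]
    intro x hx
    rw [mem_zeroLocus_iff] at hx
    rw [aeval_X, h x fun j => ?_, Pi.zero_apply]
    rw [← hx _ (Ideal.subset_span ⟨j, rfl⟩)]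
    exact (eval₂_coeffForm (RingHom.id ℂ) x c j).symm
  obtain ⟨D, hD⟩ := Ideal.exists_pow_le_of_le_radical_of_fg hrad (idealOfVars_fg _ _)
  refine exists_elimHom_eq_zero c D fun β hβ => ?_
  have h1 := homogeneousComponent_mem_span c D
    (hD ((monomial_mem_pow_idealOfVars_iff D β one_ne_zero).2 hβ.ge))
  rwa [homogeneousComponent_eq_self (isHomogeneous_monomial 1 hβ)] at h1

theorem isResultant_of_ker_elimHom {n : ℕ} {d : Fin (n + 1) → ℕ}
    {R : MvPolynomial (CoeffIdx (n + 1) d) ℤ} (h1 : resEval d (fun i => X i ^ d i) R = 1)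
    (hZ : RingHom.ker (elimHom n d ℤ) = Ideal.span {R})
    (hC : RingHom.ker (elimHom n d ℂ) = Ideal.span {MvPolynomial.map (Int.castRingHom ℂ) R}) :
    IsResultant (n + 1) d R := by
  have hR0 : R ≠ 0 := by
    rintro rfl
    simp [resEval] at h1
  have hR0' : MvPolynomial.map (Int.castRingHom ℂ) R ≠ 0 := by
    rwa [Ne, map_eq_zero_iff _ (map_injective _ Int.cast_injective)]
  refine ⟨fun F hF => ⟨?_, ?_⟩, ?_, ?_, h1⟩
  · rintro ⟨x, hx, hxF⟩
    rw [resEval_eq_eval]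
    refine eval_eq_zero_of_formEval_eq_zero ?_ _ x hx fun j => ?_
    · rw [← RingHom.mem_ker, hC]
      exact Ideal.mem_span_singleton_self _
    · rw [← hxF j]
      conv_rhs => rw [← coeffForm_coeff F hF j]
      exact (eval₂_coeffForm (RingHom.id ℂ) x _ j).symm
  · contrapose!
    intro hx
    obtain ⟨r, hr1, hr⟩ := exists_eval_eq_one_of_formEval
      (fun w : CoeffIdx (n + 1) d => coeff w.2.toFinsupp (F w.1)) (by
        intro x hxF
        by_contra hx0
        obtain ⟨i, hi⟩ := hx x hx0
        refine hi ?_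
        rw [← hxF i, ← coeffForm_coeff F hF i]
        exact eval₂_coeffForm (RingHom.id ℂ) x _ i)
    rw [← RingHom.mem_ker, hC, Ideal.mem_span_singleton] at hr
    have hu := isUnit_of_dvd_one (hr1 ▸ map_dvd (eval _) hr)
    rw [resEval_eq_eval]
    exact hu.ne_zero
  · have : (RingHom.ker (elimHom n d ℤ)).IsPrime := RingHom.ker_isPrime _
    rw [hZ, Ideal.span_singleton_prime hR0] at this
    exact this.irreducible
  · have : (RingHom.ker (elimHom n d ℂ)).IsPrime := RingHom.ker_isPrime _
    rw [hC, Ideal.span_singleton_prime hR0'] at this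
    exact this.irreducible

theorem IsResultant.dvd {m : ℕ} {d : Fin m → ℕ} {R R' : MvPolynomial (CoeffIdx m d) ℤ}
    (h : IsResultant m d R) (h' : IsResultant m d R') :
    MvPolynomial.map (Int.castRingHom ℂ) R ∣ MvPolynomial.map (Int.castRingHom ℂ) R' := by
  have hev : ∀ (c : CoeffIdx m d → ℂ) (Q : MvPolynomial (CoeffIdx m d) ℤ),
      resEval d (coeffForm c) Q = eval c (MvPolynomial.map (Int.castRingHom ℂ) Q) := by
    intro c Q
    rw [resEval_eq_eval]
    simp only [coeff_coeffForm]
  have hz : ∀ c : CoeffIdx m d → ℂ, eval c (MvPolynomial.map (Int.castRingHom ℂ) R) = 0 →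
      eval c (MvPolynomial.map (Int.castRingHom ℂ) R') = 0 := by
    intro c hc
    rw [← hev] at hc ⊢
    exact (h'.1 _ (isHomogeneous_coeffForm c)).1 ((h.1 _ (isHomogeneous_coeffForm c)).2 hc)
  have hp : Prime (MvPolynomial.map (Int.castRingHom ℂ) R) := h.2.2.1.prime
  have hprime : (Ideal.span {MvPolynomial.map (Int.castRingHom ℂ) R}).IsPrime :=
    (Ideal.span_singleton_prime hp.ne_zero).2 hp
  rw [← Ideal.mem_span_singleton, ← hprime.radical,
    ← vanishingIdeal_zeroLocus_eq_radical (K := ℂ), mem_vanishingIdeal_iff]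
  intro c hc
  exact hz c (mem_zeroLocus_iff.1 hc _ (Ideal.mem_span_singleton_self _))

theorem IsResultant.unique {m : ℕ} {d : Fin m → ℕ} {R R' : MvPolynomial (CoeffIdx m d) ℤ}
    (h : IsResultant m d R) (h' : IsResultant m d R') : R = R' := by
  obtain ⟨u, hu⟩ := associated_of_dvd_dvd (h.dvd h') (h'.dvd h)
  obtain ⟨a, -, ha⟩ := (MvPolynomial.isUnit_iff_eq_C_of_isReduced).1 u.isUnit
  have h1 := h'.2.2.2
  have h2 := h.2.2.2
  rw [resEval_eq_eval] at h1 h2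
  rw [← hu, map_mul, h2, ha, eval_C, one_mul] at h1
  rw [ha, h1, C_1, mul_one] at hu
  exact map_injective _ Int.cast_injective hu

theorem resultant_existsUnique (n : ℕ) (d : Fin (n + 1) → ℕ) (hd : ∀ i, 0 < d i) :
    ∃! R : MvPolynomial (CoeffIdx (n + 1) d) ℤ, IsResultant (n + 1) d R := by
  obtain ⟨R, hR1, hR⟩ := exists_ker_elimHom_eq_span hd
  have h := isResultant_of_ker_elimHom hR1 hR (ker_elimHom_map hR)
  exact ⟨R, h, fun R' h' => h'.unique h⟩
end

section
/- With the hypotheses of the Poisson formula (F_0,...,F_n homogeneous of degrees d_0,...,d_n in ℂ[x_0,...,x_n], f_i := F_i(x_0,...,x_{n-1},1), F̄_i := F_i(x_0,...,x_{n-1},0), and Res(F̄_0,...,F̄_{n-1}) ≠ 0), the determinant of the multiplication map m_{f_n} on A = ℂ[x_0,...,x_{n-1}]/(f_0,...,f_{n-1}) satisfies det(m_{f_n} : A → A) = Π_{p ∈ V} f_n(p)^{mult_p(V)}, where V = V(f_0,...,f_{n-1}) ⊂ 𝔸^n is the (finite) zero set of f_0,...,f_{n-1} and mult_p(V) denotes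 the multiplicity of V at the point p. -/
open MvPolynomial

/-- The quotient ring `A = ℂ[x_0,…,x_{n-1}]/(f_0,…,f_{n-1})`. -/
abbrev PoissonQuot (n : ℕ) (f : Fin (n + 1) → MvPolynomial (Fin n) ℂ) :=
  MvPolynomial (Fin n) ℂ ⧸ Ideal.span (Set.range fun i : Fin n => f i.castSucc)

/-- Evaluation of `A = ℂ[x_0,…,x_{n-1}]/(f_0,…,f_{n-1})` at a common zero `p` of
`f_0, …, f_{n-1}`. Its kernel is the maximal ideal of `A` corresponding to `p`. -/
noncomputable def evalAtPoint (n : ℕ) (f : Fin (n + 1) → MvPolynomial (Fin n) ℂ)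
    (p : Fin n → ℂ) (hp : ∀ i : Fin n, eval p (f i.castSucc) = 0) :
    PoissonQuot n f →+* ℂ :=
  Ideal.Quotient.lift _ (eval p) (by
    intro q hq
    have hle : Ideal.span (Set.range fun i : Fin n => f i.castSucc) ≤
        RingHom.ker (eval p) := by
      rw [Ideal.span_le]
      rintro _ ⟨i, rfl⟩
      simpa [RingHom.mem_ker] using hp i
    simpa [RingHom.mem_ker] using hle hq)

/-- The multiplicity `mult_p(V)` of a point `p ∈ V = V(f_0,…,f_{n-1})`: the dimension, as a
`ℂ`-vector space, of the localization of `A = ℂ[x_0,…,x_{n-1}]/(f_0,…,f_{n-1})` at the maximal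
ideal corresponding to `p` (i.e. at the multiplicative set of elements not vanishing at `p`). -/
noncomputable def localMult (n : ℕ) (f : Fin (n + 1) → MvPolynomial (Fin n) ℂ)
    (p : Fin n → ℂ) (hp : ∀ i : Fin n, eval p (f i.castSucc) = 0) : ℕ :=
  letI L := Localization
    (Submonoid.comap (evalAtPoint n f p hp).toMonoidHom (nonZeroDivisors ℂ))
  @Module.finrank ℂ L _ _
    (((algebraMap (PoissonQuot n f) L).comp (algebraMap ℂ (PoissonQuot n f))).toModule)

theorem LinearMap.det_piMap_dependent {K ι : Type*} [Field K] [Fintype ι] {M : ι → Type*}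
    [∀ i, AddCommGroup (M i)] [∀ i, Module K (M i)] [∀ i, Module.Finite K (M i)]
    (g : ∀ i, M i →ₗ[K] M i) :
    LinearMap.det (LinearMap.pi fun i => g i ∘ₗ LinearMap.proj i) =
      ∏ i, LinearMap.det (g i) := by
  classical
  let : LinearOrder ι := linearOrderOfSTO WellOrderingRel
  let b := fun i => Module.Free.chooseBasis K (M i)
  have key : LinearMap.toMatrix (Pi.basis b) (Pi.basis b)
      (LinearMap.pi fun i => g i ∘ₗ LinearMap.proj i) =
      Matrix.blockDiagonal' fun i => LinearMap.toMatrix (b i) (b i) (g i) := by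
    ext ⟨i, k⟩ ⟨j, l⟩
    rw [LinearMap.toMatrix_apply, Matrix.blockDiagonal'_apply, Pi.basis_repr, Pi.basis_apply]
    by_cases h : i = j
    · subst h
      simp [LinearMap.toMatrix_apply]
    · simp [h]
  rw [← LinearMap.det_toMatrix (Pi.basis b), key]
  have htri := Matrix.blockTriangular_blockDiagonal' fun i =>
    LinearMap.toMatrix (b i) (b i) (g i)
  rw [htri.det_fintype]
  refine Finset.prod_congr rfl fun i _ => ?_
  rw [← LinearMap.det_toMatrix (b i)]
  refine Eq.trans ?_ (Matrix.det_submatrix_equiv_self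
    (Equiv.sigmaSubtype (β := fun i => Module.Free.ChooseBasisIndex K (M i)) i)
    (LinearMap.toMatrix (b i) (b i) (g i)))
  congr! 1
  ext ⟨⟨j, k⟩, hj⟩ ⟨⟨j', l⟩, hj'⟩
  obtain rfl : j = i := hj
  obtain rfl : j' = j := hj'
  simp [Matrix.toSquareBlock, Matrix.toSquareBlockProp, Equiv.sigmaSubtype]

theorem LinearMap.det_mulLeft_of_isNilpotent_sub {K B : Type*} [Field K] [CommRing B]
    [Algebra K B] [Module.Finite K B] {b : B} {c : K} (h : IsNilpotent (b - algebraMap K B c)) :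
    LinearMap.det (LinearMap.mulLeft K b) = c ^ Module.finrank K B := by
  set N := LinearMap.mulLeft K (algebraMap K B c - b) with hN
  have hnil : IsNilpotent N := by
    have h' : IsNilpotent (algebraMap K B c - b) := by simpa using h.neg
    exact h'.map (Algebra.lmul K B)
  have hb : LinearMap.mulLeft K b = algebraMap K (Module.End K B) c - N := by
    ext x
    simp [hN, Algebra.smul_def, sub_mul]
  rw [hb, ← LinearMap.eval_charpoly, hnil.charpoly_eq_X_pow_finrank]
  simp

theorem LinearMap.det_mulLeft_eq_prod_maximalSpectrum {K A : Type*} [Field K] [CommRing A]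
    [Algebra K A] [Module.Finite K A] [Fintype (MaximalSpectrum A)] (a : A)
    (c : MaximalSpectrum A → K) (hc : ∀ I, a - algebraMap K A (c I) ∈ I.asIdeal) :
    LinearMap.det (LinearMap.mulLeft K a) =
      ∏ I, c I ^ Module.finrank K (Localization.AtPrime I.asIdeal) := by
  have : IsArtinianRing A := IsArtinianRing.of_finite K A
  let e := (MaximalSpectrum.toPiLocalizationEquiv A).restrictScalars K
  have hfin (I : MaximalSpectrum A) : Module.Finite K (Localization.AtPrime I.asIdeal) :=
    Module.Finite.of_surjective
      (LinearMap.proj (R := K) (φ := fun I : MaximalSpectrum A => Localization.AtPrime I.asIdeal) I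
        ∘ₗ e.toLinearMap)
      ((Function.surjective_eval I).comp e.surjective)
  rw [← LinearMap.det_conj _ e.toLinearEquiv]
  have : e.toLinearEquiv.toLinearMap ∘ₗ LinearMap.mulLeft K a ∘ₗ e.toLinearEquiv.symm.toLinearMap =
      LinearMap.pi fun I : MaximalSpectrum A => LinearMap.mulLeft K (algebraMap A (Localization.AtPrime I.asIdeal) a)
        ∘ₗ LinearMap.proj I := by
    refine LinearMap.ext fun x => ?_
    obtain ⟨y, rfl⟩ := e.surjective x
    ext I
    simp [e]
  rw [this, LinearMap.det_piMap_dependent]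
  refine Finset.prod_congr rfl fun I _ => LinearMap.det_mulLeft_of_isNilpotent_sub ?_
  have hart : IsArtinianRing (Localization.AtPrime I.asIdeal) := IsArtinianRing.of_finite K _
  have hmem : algebraMap A (Localization.AtPrime I.asIdeal) a -
      algebraMap K (Localization.AtPrime I.asIdeal) (c I) ∈
        IsLocalRing.maximalIdeal (Localization.AtPrime I.asIdeal) := by
    rw [IsScalarTower.algebraMap_apply K A (Localization.AtPrime I.asIdeal), ← map_sub,
      IsLocalization.AtPrime.to_map_mem_maximal_iff _ I.asIdeal]
    exact hc I
  rw [← IsLocalRing.jacobson_eq_maximalIdeal ⊥ bot_ne_top] at hmem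
  obtain ⟨k, hk⟩ := IsArtinianRing.isNilpotent_jacobson_bot (R := Localization.AtPrime I.asIdeal)
  exact ⟨k, by simpa [hk] using Ideal.pow_mem_pow hmem k⟩

theorem MvPolynomial.exists_X_pow_mem_of_forall_eq_zero {σ ι K : Type*} [Finite σ] [Field K]
    [IsAlgClosed K] (G : ι → MvPolynomial σ K)
    (h : ∀ x : σ → K, (∀ i, eval x (G i) = 0) → x = 0) :
    ∃ N, ∀ j, X j ^ N ∈ Ideal.span (Set.range G) := by
  have hrad (j : σ) : X j ∈ (Ideal.span (Set.range G)).radical := by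
    rw [← vanishingIdeal_zeroLocus_eq_radical (K := K)]
    intro x hx
    have hx0 : x = 0 := h x fun i => hx (G i) (Ideal.subset_span ⟨i, rfl⟩)
    simp [hx0]
  choose N hN using hrad
  cases nonempty_fintype σ
  exact ⟨∑ j, N j, fun j => Ideal.pow_mem_of_pow_mem _ (hN j)
    (Finset.single_le_sum (fun _ _ => Nat.zero_le _) (Finset.mem_univ j))⟩

section
attribute [local instance] MvPolynomial.gradedAlgebra

theorem MvPolynomial.homogeneousComponent_mul_of_isHomogeneous {σ R : Type*} [CommRing R]
    {e : ℕ} {g : MvPolynomial σ R} (hg : g.IsHomogeneous e) (c : MvPolynomial σ R) (N : ℕ) :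
    homogeneousComponent N (c * g) =
      if e ≤ N then homogeneousComponent (N - e) c * g else 0 := by
  have h := DirectSum.coe_decompose_mul_of_right_mem (homogeneousSubmodule σ R) N (a := c)
    ((mem_homogeneousSubmodule e g).mpr hg)
  change (decomposition.decompose' (c * g) N : MvPolynomial σ R) =
    if e ≤ N then (decomposition.decompose' c (N - e) : MvPolynomial σ R) * g else 0 at h
  simpa only [decomposition.decompose'_apply] using h
end

theorem MvPolynomial.sum_eq_zero_or_totalDegree_lt {σ ι R : Type*} [CommSemiring R]
    {s : Finset ι} {p : ι → MvPolynomial σ R} {N : ℕ}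
    (h : ∀ i ∈ s, p i = 0 ∨ (p i).totalDegree < N) :
    ∑ i ∈ s, p i = 0 ∨ (∑ i ∈ s, p i).totalDegree < N := by
  refine or_iff_not_imp_left.mpr fun h0 => ?_
  obtain ⟨i, his, hi⟩ := Finset.exists_ne_zero_of_sum_ne_zero h0
  have hN : 0 < N := (Nat.zero_le _).trans_lt ((h i his).resolve_left hi)
  refine (totalDegree_finsetSum _ _).trans_lt ((Finset.sup_lt_iff hN).mpr fun j hj => ?_)
  rcases h j hj with h' | h'
  · simpa [h'] using hN
  · exact h'

theorem MvPolynomial.exists_congr_X_pow {σ ι R : Type*} [Fintype ι] [CommRing R]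
    {g G : ι → MvPolynomial σ R} {d : ι → ℕ} (hG : ∀ i, (G i).IsHomogeneous (d i))
    (hg : ∀ i, g i - G i = 0 ∨ (g i - G i).totalDegree < d i)
    {j : σ} {N : ℕ} (hN : X j ^ N ∈ Ideal.span (Set.range G)) :
    ∃ q : MvPolynomial σ R, (q = 0 ∨ q.totalDegree < N) ∧
      X j ^ N - q ∈ Ideal.span (Set.range g) := by
  obtain ⟨c, hc⟩ := (Ideal.mem_span_range_iff_exists_fun).mp hN
  let c' := fun i => if d i ≤ N then homogeneousComponent (N - d i) (c i) else 0
  have hc' : ∑ i, c' i * G i = X j ^ N := by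
    have := congrArg (homogeneousComponent N) hc
    rw [map_sum, homogeneousComponent_eq_self (isHomogeneous_X_pow j N)] at this
    rw [← this]
    refine Finset.sum_congr rfl fun i _ => ?_
    rw [homogeneousComponent_mul_of_isHomogeneous (hG i)]
    simp only [c', ite_mul, zero_mul]
  refine ⟨- ∑ i, c' i * (g i - G i), ?_, ?_⟩
  · rw [neg_eq_zero, totalDegree_neg]
    refine sum_eq_zero_or_totalDegree_lt fun i _ => or_iff_not_imp_left.mpr fun hi => ?_
    have hlt := (hg i).resolve_left (right_ne_zero_of_mul hi)
    by_cases hd : d i ≤ N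
    · have h1 := totalDegree_mul (c' i) (g i - G i)
      have h2 : (c' i).totalDegree ≤ N - d i := by
        simpa only [c', if_pos hd] using
          (homogeneousComponent_isHomogeneous (N - d i) (c i)).totalDegree_le
      omega
    · simp [c', hd] at hi
  · have : X j ^ N - -∑ i, c' i * (g i - G i) = ∑ i, c' i * g i := by
      rw [← hc', sub_neg_eq_add, ← Finset.sum_add_distrib]
      exact Finset.sum_congr rfl fun i _ => by ring
    rw [this]
    exact sum_mem fun i _ => Ideal.mul_mem_left _ _ (Ideal.subset_span ⟨i, rfl⟩)

theorem MvPolynomial.finite_quotient_of_X_pow_congr {σ R : Type*} [Fintype σ] [CommRing R]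
    (I : Ideal (MvPolynomial σ R)) (N : ℕ)
    (h : ∀ j, ∃ q : MvPolynomial σ R, (q = 0 ∨ q.totalDegree < N) ∧ X j ^ N - q ∈ I) :
    Module.Finite R (MvPolynomial σ R ⧸ I) := by
  set M := Fintype.card σ * N
  have key : ∀ k, ∀ p : MvPolynomial σ R, p.totalDegree ≤ k →
      ∃ q ∈ restrictTotalDegree σ R M, p - q ∈ I := by
    intro k
    induction k using Nat.strong_induction_on with
    | _ k ih =>
      intro p hp
      suffices H : ∀ s ∈ p.support, ∃ q ∈ restrictTotalDegree σ R M,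
          monomial s (coeff s p) - q ∈ I by
        choose! q hq1 hq2 using H
        refine ⟨∑ s ∈ p.support, q s, sum_mem hq1, ?_⟩
        nth_rw 1 [p.as_sum]
        rw [← Finset.sum_sub_distrib]
        exact sum_mem hq2
      intro s hs
      have hsk : s.degree ≤ k := (le_totalDegree hs).trans hp
      by_cases hsM : s.degree ≤ M
      · refine ⟨monomial s (coeff s p), ?_, by simp⟩
        rw [mem_restrictTotalDegree]
        exact (totalDegree_monomial_le _ _).trans hsM
      obtain ⟨j, hj⟩ : ∃ j, N ≤ s j := by
        by_contra! hlt
        apply hsM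
        rw [Finsupp.degree_eq_sum]
        refine (Finset.sum_le_card_nsmul _ _ N fun j _ => (hlt j).le).trans ?_
        simp [M]
      obtain ⟨r, hr, hrI⟩ := h j
      let t := s - Finsupp.single j N
      have hts : t + Finsupp.single j N = s :=
        tsub_add_cancel_of_le (by simpa using hj)
      have hmon : monomial s (coeff s p) = monomial t (coeff s p) * X j ^ N := by
        rw [X_pow_eq_monomial, monomial_mul, hts, mul_one]
      have hdeg : t.degree + N = s.degree := by
        rw [← hts, map_add, Finsupp.degree_single]
      rcases hr with rfl | hr
      · refine ⟨0, zero_mem _, ?_⟩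
        rw [hmon, sub_zero]
        exact I.mul_mem_left _ (by simpa using hrI)
      have hlt : (monomial t (coeff s p) * r).totalDegree < k := by
        have h1 := totalDegree_mul (monomial t (coeff s p)) r
        have h2 : (monomial t (coeff s p)).totalDegree ≤ t.degree := totalDegree_monomial_le _ _
        omega
      obtain ⟨q, hq, hqI⟩ := ih _ hlt _ le_rfl
      refine ⟨q, hq, ?_⟩
      have : monomial s (coeff s p) - q =
          monomial t (coeff s p) * (X j ^ N - r) + (monomial t (coeff s p) * r - q) := by
        rw [hmon]; ring
      rw [this]
      exact I.add_mem (I.mul_mem_left _ hrI) hqI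
  refine Module.Finite.of_surjective
    ((Ideal.Quotient.mkₐ R I).toLinearMap ∘ₗ (restrictTotalDegree σ R M).subtype) fun y => ?_
  obtain ⟨p, rfl⟩ := Ideal.Quotient.mk_surjective y
  obtain ⟨q, hq, hqI⟩ := key _ p le_rfl
  exact ⟨⟨q, hq⟩, ((Ideal.Quotient.mk_eq_mk_iff_sub_mem _ _).mpr hqI).symm⟩

theorem MvPolynomial.aeval_snoc_one_sub_aeval_snoc_zero {R : Type*} [CommRing R] {n e : ℕ}
    {F : MvPolynomial (Fin (n + 1)) R} (hF : F.IsHomogeneous e) :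
    aeval (Fin.snoc (fun j => X j) (1 : MvPolynomial (Fin n) R) : Fin (n + 1) → _) F -
        aeval (Fin.snoc (fun j => X j) (0 : MvPolynomial (Fin n) R) : Fin (n + 1) → _) F = 0 ∨
      (aeval (Fin.snoc (fun j => X j) (1 : MvPolynomial (Fin n) R) : Fin (n + 1) → _) F -
        aeval (Fin.snoc (fun j => X j) (0 : MvPolynomial (Fin n) R) :
          Fin (n + 1) → _) F).totalDegree < e := by
  have hmon (a : MvPolynomial (Fin n) R) (s : Fin (n + 1) →₀ ℕ) (c : R) :
      aeval (Fin.snoc (fun j => X j) a : Fin (n + 1) → MvPolynomial (Fin n) R) (monomial s c) =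
        C c * (∏ j : Fin n, X j ^ s j.castSucc) * a ^ s (Fin.last n) := by
    rw [aeval_monomial, Finsupp.prod_fintype _ _ fun _ => pow_zero _, Fin.prod_univ_castSucc]
    simp [mul_assoc, algebraMap_eq]
  rw [F.as_sum, map_sum, map_sum, ← Finset.sum_sub_distrib]
  refine sum_eq_zero_or_totalDegree_lt fun s hs => ?_
  rw [hmon, hmon]
  by_cases h0 : s (Fin.last n) = 0
  · left; simp [h0]
  right
  have hdeg : s.degree = e := by
    have := hF (mem_support_iff.mp hs)
    rwa [Finsupp.degree_eq_weight_one]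
  rw [Finsupp.degree_eq_sum, Fin.sum_univ_castSucc] at hdeg
  rw [one_pow, zero_pow h0, mul_one, mul_zero, sub_zero]
  have h1 := totalDegree_mul (C (coeff s F))
    (∏ j : Fin n, (X j : MvPolynomial (Fin n) R) ^ s j.castSucc)
  have h2 : (∏ j : Fin n, (X j : MvPolynomial (Fin n) R) ^ s j.castSucc).totalDegree ≤
      ∑ j : Fin n, s j.castSucc := by
    refine (totalDegree_finsetProd _ _).trans (Finset.sum_le_sum fun j _ => ?_)
    rw [X_pow_eq_monomial]
    exact (totalDegree_monomial_le _ _).trans (by simp)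
  rw [totalDegree_C, zero_add] at h1
  omega

theorem evalAtPoint_mk (n : ℕ) (f : Fin (n + 1) → MvPolynomial (Fin n) ℂ) (p : Fin n → ℂ)
    (hp : ∀ i : Fin n, eval p (f i.castSucc) = 0) (q : MvPolynomial (Fin n) ℂ) :
    evalAtPoint n f p hp (Ideal.Quotient.mk _ q) = eval p q := rfl

theorem evalAtPoint_surjective (n : ℕ) (f : Fin (n + 1) → MvPolynomial (Fin n) ℂ) (p : Fin n → ℂ)
    (hp : ∀ i : Fin n, eval p (f i.castSucc) = 0) :
    Function.Surjective (evalAtPoint n f p hp) := fun c =>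
  ⟨Ideal.Quotient.mk _ (C c), by rw [evalAtPoint_mk, eval_C]⟩

/-- The maximal ideal of `ℂ[x_0,…,x_{n-1}]/(f_0,…,f_{n-1})` corresponding to a common zero. -/
noncomputable def pointToMaximalSpectrum (n : ℕ) (f : Fin (n + 1) → MvPolynomial (Fin n) ℂ)
    (p : {p : Fin n → ℂ // ∀ i : Fin n, eval p (f i.castSucc) = 0}) :
    MaximalSpectrum (PoissonQuot n f) :=
  ⟨RingHom.ker (evalAtPoint n f p.1 p.2),
    RingHom.ker_isMaximal_of_surjective _ (evalAtPoint_surjective n f p.1 p.2)⟩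

theorem pointToMaximalSpectrum_bijective (n : ℕ) (f : Fin (n + 1) → MvPolynomial (Fin n) ℂ) :
    Function.Bijective (pointToMaximalSpectrum n f) := by
  constructor
  · intro p q hpq
    ext j
    have hmem : Ideal.Quotient.mk _ (X j - C (p.1 j)) ∈
        (pointToMaximalSpectrum n f p).asIdeal := by
      simp [pointToMaximalSpectrum, RingHom.mem_ker, evalAtPoint_mk, -map_sub, eval_sub]
    rw [hpq] at hmem
    change evalAtPoint n f q.1 q.2 _ = 0 at hmem
    rw [evalAtPoint_mk, eval_sub, eval_X, eval_C, sub_eq_zero] at hmem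
    exact hmem.symm
  · intro M
    have hM := M.isMaximal
    have hmax := Ideal.comap_isMaximal_of_surjective
      (Ideal.Quotient.mk (Ideal.span (Set.range fun i : Fin n => f i.castSucc)))
      Ideal.Quotient.mk_surjective (K := M.asIdeal)
    obtain ⟨x, hx⟩ := isMaximal_iff_eq_vanishingIdeal_singleton.mp hmax
    have hiff (q : MvPolynomial (Fin n) ℂ) :
        Ideal.Quotient.mk _ q ∈ M.asIdeal ↔ eval x q = 0 := by
      rw [← Ideal.mem_comap, hx, mem_vanishingIdeal_singleton_iff, aeval_eq_eval]
    have hxV (i : Fin n) : eval x (f i.castSucc) = 0 := by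
      rw [← hiff, Ideal.Quotient.eq_zero_iff_mem.mpr (Ideal.subset_span (Set.mem_range_self i))]
      exact zero_mem _
    refine ⟨⟨x, hxV⟩, MaximalSpectrum.ext (Ideal.ext fun y => ?_)⟩
    obtain ⟨q, rfl⟩ := Ideal.Quotient.mk_surjective y
    exact (hiff q).symm

theorem Localization.finrank_toModule_eq {K A : Type*} [Field K] [CommRing A] [Algebra K A]
    {S T : Submonoid A} (h : S = T) :
    @Module.finrank K (Localization S) _ _
      (((algebraMap A (Localization S)).comp (algebraMap K A)).toModule) =
    Module.finrank K (Localization T) := by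
  subst h
  congr 1
  refine Module.ext' _ _ fun r m => ?_
  rw [Algebra.smul_def, IsScalarTower.algebraMap_apply K A (Localization S)]
  rfl

theorem localMult_eq_finrank (n : ℕ) (f : Fin (n + 1) → MvPolynomial (Fin n) ℂ)
    (p : {p : Fin n → ℂ // ∀ i : Fin n, eval p (f i.castSucc) = 0}) :
    localMult n f p.1 p.2 =
      Module.finrank ℂ (Localization.AtPrime (pointToMaximalSpectrum n f p).asIdeal) := by
  refine Localization.finrank_toModule_eq (Submonoid.ext fun y => ?_)
  simp [pointToMaximalSpectrum, Ideal.mem_primeCompl_iff, RingHom.mem_ker]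

theorem finite_poissonQuot {n : ℕ} {d : Fin (n + 1) → ℕ}
    {F : Fin (n + 1) → MvPolynomial (Fin (n + 1)) ℂ} (hF : ∀ i, (F i).IsHomogeneous (d i))
    {f Fbar : Fin (n + 1) → MvPolynomial (Fin n) ℂ}
    (hf : ∀ i, f i = aeval (Fin.snoc (fun j => X j) (1 : MvPolynomial (Fin n) ℂ)) (F i))
    (hFbar : ∀ i, Fbar i = aeval (Fin.snoc (fun j => X j) (0 : MvPolynomial (Fin n) ℂ)) (F i))
    (hhom : ∀ i, (Fbar i).IsHomogeneous (d i))
    (h0 : ∀ x : Fin n → ℂ, (∀ i : Fin n, eval x (Fbar i.castSucc) = 0) → x = 0) :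
    Module.Finite ℂ (PoissonQuot n f) := by
  obtain ⟨N, hN⟩ := exists_X_pow_mem_of_forall_eq_zero (fun i : Fin n => Fbar i.castSucc) h0
  have hdiff (i : Fin n) : f i.castSucc - Fbar i.castSucc = 0 ∨
      (f i.castSucc - Fbar i.castSucc).totalDegree < d i.castSucc := by
    rw [hf, hFbar]
    exact aeval_snoc_one_sub_aeval_snoc_zero (hF _)
  exact finite_quotient_of_X_pow_congr _ N fun j =>
    exists_congr_X_pow (d := fun i : Fin n => d i.castSucc) (fun i => hhom i.castSucc) hdiff (hN j)

/-- With the hypotheses of the Poisson formula, the determinant of the multiplication map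
`m_{f_n}` on `A = ℂ[x_0,…,x_{n-1}]/(f_0,…,f_{n-1})` equals
`∏_{p ∈ V} f_n(p)^{mult_p(V)}`, where `V = V(f_0,…,f_{n-1}) ⊂ 𝔸^n`. -/
theorem det_mul_map_eq_prod_multiplicities (n : ℕ) (d : Fin (n + 1) → ℕ) (hd : ∀ i, 0 < d i)
    (R : MvPolynomial (CoeffIdx (n + 1) d) ℤ) (hR : IsResultant (n + 1) d R)
    (R' : MvPolynomial (CoeffIdx n fun i => d i.castSucc) ℤ)
    (hR' : IsResultant n (fun i => d i.castSucc) R')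
    (F : Fin (n + 1) → MvPolynomial (Fin (n + 1)) ℂ)
    (hF : ∀ i, (F i).IsHomogeneous (d i))
    (f Fbar : Fin (n + 1) → MvPolynomial (Fin n) ℂ)
    (hf : ∀ i, f i = aeval (Fin.snoc (fun j => X j) (1 : MvPolynomial (Fin n) ℂ)) (F i))
    (hFbar : ∀ i, Fbar i = aeval (Fin.snoc (fun j => X j) (0 : MvPolynomial (Fin n) ℂ)) (F i))
    (hres : resEval (fun i => d i.castSucc) (fun i => Fbar i.castSucc) R' ≠ 0) :
    LinearMap.det
        (LinearMap.mulLeft ℂ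
          (Ideal.Quotient.mk (Ideal.span (Set.range fun i : Fin n => f i.castSucc))
            (f (Fin.last n)))) =
      ∏ᶠ (p : Fin n → ℂ) (hp : ∀ i : Fin n, eval p (f i.castSucc) = 0),
        eval p (f (Fin.last n)) ^ localMult n f p hp := by
  have hhom (i : Fin (n + 1)) : (Fbar i).IsHomogeneous (d i) := by
    rw [hFbar, ← one_mul (d i)]
    refine (hF i).aeval _ fun k => ?_
    refine Fin.lastCases ?_ (fun j => ?_) k
    · rw [Fin.snoc_last]
      exact isHomogeneous_zero _ _ _
    · rw [Fin.snoc_castSucc]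
      exact isHomogeneous_X _ _
  have hfin : Module.Finite ℂ (PoissonQuot n f) := by
    refine finite_poissonQuot hF hf hFbar hhom fun x hx => by_contra fun hx0 => hres ?_
    exact (hR'.1 _ fun i => hhom i.castSucc).mp ⟨x, hx0, hx⟩
  have : IsArtinianRing (PoissonQuot n f) := IsArtinianRing.of_finite ℂ _
  have := Fintype.ofFinite (MaximalSpectrum (PoissonQuot n f))
  let V : Set (Fin n → ℂ) := {p | ∀ i : Fin n, eval p (f i.castSucc) = 0}
  let e : V ≃ MaximalSpectrum (PoissonQuot n f) :=
    Equiv.ofBijective _ (pointToMaximalSpectrum_bijective n f)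
  have hc (I : MaximalSpectrum (PoissonQuot n f)) :
      Ideal.Quotient.mk _ (f (Fin.last n)) -
        algebraMap ℂ (PoissonQuot n f) (eval (e.symm I).1 (f (Fin.last n))) ∈ I.asIdeal := by
    obtain ⟨p, rfl⟩ := e.surjective I
    rw [e.symm_apply_apply]
    change evalAtPoint n f p.1 p.2
      (Ideal.Quotient.mk _ (f (Fin.last n) - C (eval p.1 (f (Fin.last n))))) = 0
    rw [evalAtPoint_mk, eval_sub, eval_C, sub_self]
  rw [LinearMap.det_mulLeft_eq_prod_maximalSpectrum _ _ hc, ← finprod_eq_prod_of_fintype]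
  classical
  let g : (Fin n → ℂ) → ℂ := fun p =>
    if hp : p ∈ V then eval p (f (Fin.last n)) ^ localMult n f p hp else 1
  have hg (p : Fin n → ℂ) : (∏ᶠ hp : ∀ i : Fin n, eval p (f i.castSucc) = 0,
      eval p (f (Fin.last n)) ^ localMult n f p hp) = ∏ᶠ _ : p ∈ V, g p :=
    finprod_congr fun hp => by simp only [g, dif_pos (show p ∈ V from hp)]
  rw [finprod_congr hg, ← finprod_set_coe_eq_finprod_mem]
  refine (finprod_eq_of_bijective e e.bijective fun p => ?_).symm
  rw [e.symm_apply_apply]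
  exact (dif_pos p.2).trans (congrArg _ (localMult_eq_finrank n f p))
end
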